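/- Let n ≥ 4 be an integer and let k', k'' be integers with 1 ≤ k' < k'' such that π(n − k'') = k' and π(n − k') = k''. Then there is no positive integer k with π(n − k) = k. -/

import Mathlib

theorem primeCounting_add_le_add (x m : ℕ) :
    Nat.primeCounting (x + m) ≤ Nat.primeCounting x + m := by
  induction m with
  | zero => simp
  | succ m ih =>
    have h : Nat.primeCounting (x + m + 1) ≤ Nat.primeCounting (x + m) + 1 := by
      simp only [Nat.primeCounting, Nat.primeCounting', Nat.count_succ]
      split_ifs <;> omega
    rw [← add_assoc]
    omega

theorem primeCounting_add_two_le {x : ℕ} (hx : 2 ≤ x) :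
    Nat.primeCounting (x + 2) ≤ Nat.primeCounting x + 1 := by
  have h : ¬ (Nat.Prime (x + 1) ∧ Nat.Prime (x + 2)) := by
    rintro ⟨h₁, h₂⟩
    have := h₁.eq_two_or_odd
    have := h₂.eq_two_or_odd
    omega
  simp only [Nat.primeCounting, Nat.primeCounting']
  rw [Nat.count_succ Nat.Prime (x + 2), Nat.count_succ Nat.Prime (x + 1)]
  split_ifs <;> first | omega | exact absurd ⟨‹_›, ‹_›⟩ h

theorem stmt_8 (n k' k'' : ℕ) (hn : 4 ≤ n) (hk' : 1 ≤ k') (hlt : k' < k'')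
    (h1 : Nat.primeCounting (n - k'') = k') (h2 : Nat.primeCounting (n - k') = k'') :
    ¬ ∃ k : ℕ, 0 < k ∧ Nat.primeCounting (n - k) = k := by
  rintro ⟨k, -, hk⟩
  have hx : 2 ≤ n - k'' := by
    by_contra! h
    have h₀ : Nat.primeCounting (n - k'') ≤ Nat.primeCounting 1 :=
      Nat.monotone_primeCounting (by omega)
    rw [Nat.primeCounting_one] at h₀
    omega
  have hk₁ : k' < k := by
    by_contra! h
    have := Nat.monotone_primeCounting (show n - k' ≤ n - k by omega)
    omega
  have hk₂ : k < k'' := by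
    by_contra! h
    have := Nat.monotone_primeCounting (show n - k ≤ n - k'' by omega)
    omega
  have h₁ := primeCounting_add_two_le hx
  have h₂ := primeCounting_add_le_add (n - k'' + 2) (k'' - k' - 2)
  rw [show n - k'' + 2 + (k'' - k' - 2) = n - k' by omega] at h₂
  omega
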